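/- For all integers k ≥ 1 and t ≥ k+1, B_0(k, 2t−1) + B_1(k+1, 2t) = B_0(k, 2t−2k−1) + p_{de}(2t−k−1), where B_0 and B_1 are taken to vanish when their second argument is less than their first. -/

import Mathlib

/-!
Definitions following Andrews–El Bachraoui / Chen–Chen–Zhao:
partitions with repeated smallest part.
-/

/-- The smallest part of `π` occurs exactly `k` times and all remaining parts
occur exactly once (are distinct). -/
def IsSptD (k : ℕ) {n : ℕ} (π : n.Partition) : Prop :=
  ∃ s ∈ π.parts, (∀ x ∈ π.parts, s ≤ x) ∧ Multiset.count s π.parts = k ∧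
    ∀ x ∈ π.parts, x ≠ s → Multiset.count x π.parts = 1

/-- `spt k_d(n)`: the number of partitions of `n` whose smallest part occurs
exactly `k` times and whose remaining parts are distinct. -/
noncomputable def sptd (k n : ℕ) : ℕ :=
  Nat.card {π : n.Partition // IsSptD k π}

/-- The smallest part `s` of `π` occurs exactly `k` times, and all remaining parts
occur exactly once and are incongruent to `s` modulo 2. -/
def IsSptDO (k : ℕ) {n : ℕ} (π : n.Partition) : Prop :=
  ∃ s ∈ π.parts, (∀ x ∈ π.parts, s ≤ x) ∧ Multiset.count s π.parts = k ∧
    ∀ x ∈ π.parts, x ≠ s → Multiset.count x π.parts = 1 ∧ ¬ x % 2 = s % 2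

/-- `spt k_{do}(n)`. -/
noncomputable def sptdo (k n : ℕ) : ℕ :=
  Nat.card {π : n.Partition // IsSptDO k π}

/-- As `IsSptDO`, with in addition an even number of parts strictly greater
than the smallest part. -/
def IsSptDOEven (k : ℕ) {n : ℕ} (π : n.Partition) : Prop :=
  ∃ s ∈ π.parts, (∀ x ∈ π.parts, s ≤ x) ∧ Multiset.count s π.parts = k ∧
    (∀ x ∈ π.parts, x ≠ s → Multiset.count x π.parts = 1 ∧ ¬ x % 2 = s % 2) ∧
    Even (Multiset.card (π.parts.filter fun x => s < x))

/-- As `IsSptDO`, with in addition an odd number of parts strictly greater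
than the smallest part. -/
def IsSptDOOdd (k : ℕ) {n : ℕ} (π : n.Partition) : Prop :=
  ∃ s ∈ π.parts, (∀ x ∈ π.parts, s ≤ x) ∧ Multiset.count s π.parts = k ∧
    (∀ x ∈ π.parts, x ≠ s → Multiset.count x π.parts = 1 ∧ ¬ x % 2 = s % 2) ∧
    Odd (Multiset.card (π.parts.filter fun x => s < x))

/-- `B₀(k,n)`. -/
noncomputable def B0 (k n : ℕ) : ℕ :=
  Nat.card {π : n.Partition // IsSptDOEven k π}

/-- `B₁(k,n)`. -/
noncomputable def B1 (k n : ℕ) : ℕ :=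
  Nat.card {π : n.Partition // IsSptDOOdd k π}

/-- `spt k'_{do}(n) = B₀(k,n) - B₁(k,n)`. -/
noncomputable def sptdo' (k n : ℕ) : ℤ :=
  (B0 k n : ℤ) - (B1 k n : ℤ)

/-- `p_d(n)`: number of partitions of `n` into distinct parts. -/
noncomputable def pd (n : ℕ) : ℕ :=
  Nat.card {π : n.Partition // π.parts.Nodup}

/-- `p_{de}(n)`: number of partitions of `n` into distinct even parts. -/
noncomputable def pde (n : ℕ) : ℕ :=
  Nat.card {π : n.Partition // π.parts.Nodup ∧ ∀ x ∈ π.parts, Even x}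

/-- `p_{do}(n)`: number of partitions of `n` into distinct odd parts. -/
noncomputable def pdo (n : ℕ) : ℕ :=
  Nat.card {π : n.Partition // π.parts.Nodup ∧ ∀ x ∈ π.parts, Odd x}

/-- `p'_{do}(n)`: partitions of `n` into an even number of distinct odd parts
minus those into an odd number of distinct odd parts. -/
noncomputable def pdo' (n : ℕ) : ℤ :=
  (Nat.card {π : n.Partition //
      π.parts.Nodup ∧ (∀ x ∈ π.parts, Odd x) ∧ Even (Multiset.card π.parts)} : ℤ) -
  (Nat.card {π : n.Partition //
      π.parts.Nodup ∧ (∀ x ∈ π.parts, Odd x) ∧ Odd (Multiset.card π.parts)} : ℤ)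

/-- Pairs `(s, T)` encoding a partition of `n` whose smallest part `s` occurs `k` times and whose
remaining parts form the set `T`, all of them incongruent to `s` modulo 2, with `Q` holding
for the number of remaining parts. -/
def sptPairs (Q : ℕ → Prop) (k n : ℕ) : Set (ℕ × Finset ℕ) :=
  {p | 0 < p.1 ∧ (∀ x ∈ p.2, p.1 < x ∧ ¬ x % 2 = p.1 % 2) ∧ Q p.2.card ∧
    k * p.1 + ∑ x ∈ p.2, x = n}

/-- Finite sets of positive even numbers with sum `n`. -/
def evenSets (n : ℕ) : Set (Finset ℕ) :=
  {T | (∀ x ∈ T, 0 < x ∧ Even x) ∧ ∑ x ∈ T, x = n}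

/-- The partition encoded by an element of `sptPairs`. -/
def sptPairs.toPartition {Q : ℕ → Prop} {k n : ℕ} (p : sptPairs Q k n) : n.Partition where
  parts := Multiset.replicate k p.1.1 + p.1.2.val
  parts_pos := by
    intro i hi
    rcases Multiset.mem_add.1 hi with hi | hi
    · rw [Multiset.eq_of_mem_replicate hi]
      exact p.2.1
    · exact lt_of_le_of_lt (Nat.zero_le _) (p.2.2.1 i hi).1
  parts_sum := by
    rw [Multiset.sum_add, Multiset.sum_replicate, Finset.sum_val]
    exact p.2.2.2.2

theorem sptPairs.filter_toPartition {Q : ℕ → Prop} {k n : ℕ} (p : sptPairs Q k n) :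
    ((toPartition p).parts.filter fun x => p.1.1 < x) = p.1.2.val := by
  simp only [toPartition, Multiset.filter_add]
  rw [Multiset.filter_eq_nil.2, Multiset.filter_eq_self.2, zero_add]
  · exact fun x hx => (p.2.2.1 x hx).1
  · intro x hx
    rw [Multiset.eq_of_mem_replicate hx]
    exact lt_irrefl _

theorem sptPairs.isLeast_toPartition {Q : ℕ → Prop} {k n : ℕ} (hk : 1 ≤ k) (p : sptPairs Q k n) :
    p.1.1 ∈ (toPartition p).parts ∧ ∀ x ∈ (toPartition p).parts, p.1.1 ≤ x := by
  constructor
  · exact Multiset.mem_add.2 (Or.inl (Multiset.mem_replicate.2 ⟨by omega, rfl⟩))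
  · intro x hx
    rcases Multiset.mem_add.1 hx with hx | hx
    · exact (Multiset.eq_of_mem_replicate hx).ge
    · exact (p.2.2.1 x hx).1.le

theorem sptPairs.toPartition_injective {Q : ℕ → Prop} {k n : ℕ} (hk : 1 ≤ k) :
    Function.Injective (toPartition : sptPairs Q k n → n.Partition) := by
  intro p q h
  have hp := isLeast_toPartition hk p
  have hq := isLeast_toPartition hk q
  have fp := filter_toPartition p
  have fq := filter_toPartition q
  rw [h] at hp fp
  have hs : p.1.1 = q.1.1 := le_antisymm (hp.2 _ hq.1) (hq.2 _ hp.1)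
  rw [hs, fq] at fp
  exact Subtype.ext (Prod.ext hs (Finset.val_injective fp.symm))

theorem sptPairs.range_toPartition {Q : ℕ → Prop} {k n : ℕ} (hk : 1 ≤ k) :
    Set.range (toPartition : sptPairs Q k n → n.Partition) =
      {π | ∃ s ∈ π.parts, (∀ x ∈ π.parts, s ≤ x) ∧ Multiset.count s π.parts = k ∧
        (∀ x ∈ π.parts, x ≠ s → Multiset.count x π.parts = 1 ∧ ¬ x % 2 = s % 2) ∧
        Q (Multiset.card (π.parts.filter fun x => s < x))} := by
  ext π
  constructor
  · rintro ⟨p, rfl⟩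
    refine ⟨p.1.1, (isLeast_toPartition hk p).1, (isLeast_toPartition hk p).2, ?_, ?_, ?_⟩
    · have : p.1.1 ∉ p.1.2.val := fun h => lt_irrefl _ (p.2.2.1 _ h).1
      simp [toPartition, Multiset.count_eq_zero_of_notMem this]
    · intro x hx hne
      have hx' : x ∈ p.1.2.val := by
        rcases Multiset.mem_add.1 hx with hx | hx
        · exact absurd (Multiset.eq_of_mem_replicate hx) hne
        · exact hx
      refine ⟨?_, (p.2.2.1 x hx').2⟩
      simp [toPartition, Multiset.count_replicate, hne.symm,
        Multiset.count_eq_one_of_mem p.1.2.nodup hx']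
    · rw [filter_toPartition]
      exact p.2.2.2.1
  · rintro ⟨s, hs, hmin, hcount, hrest, hQ⟩
    have hnd : (π.parts.filter fun x => s < x).Nodup := by
      rw [Multiset.nodup_iff_count_le_one]
      intro x
      rw [Multiset.count_filter]
      split_ifs with h
      · by_cases hx : x ∈ π.parts
        · exact (hrest x hx h.ne').1.le
        · simp [Multiset.count_eq_zero_of_notMem hx]
      · exact Nat.zero_le _
    have hparts : Multiset.replicate k s + (π.parts.filter fun x => s < x) = π.parts := by
      ext x
      rw [Multiset.count_add, Multiset.count_replicate, Multiset.count_filter]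
      rcases lt_trichotomy s x with h | h | h
      · simp [h, h.ne]
      · subst h
        simp [hcount]
      · have : x ∉ π.parts := fun hx => absurd (hmin x hx) (not_le.2 h)
        simp [h.ne', Multiset.count_eq_zero_of_notMem this]
    refine ⟨⟨(s, ⟨_, hnd⟩), π.parts_pos hs, ?_, hQ, ?_⟩, ?_⟩
    · intro x hx
      obtain ⟨hx, hlt⟩ := Multiset.mem_filter.1 hx
      exact ⟨hlt, (hrest x hx hlt.ne').2⟩
    · have := congrArg Multiset.sum hparts
      rw [π.parts_sum, Multiset.sum_add, Multiset.sum_replicate] at this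
      rw [Finset.sum_eq_multiset_sum, Multiset.map_id']
      exact this
    · exact Nat.Partition.ext hparts

theorem sptPairs_finite {Q : ℕ → Prop} {k n : ℕ} (hk : 1 ≤ k) : (sptPairs Q k n).Finite :=
  Set.finite_coe_iff.1 (Finite.of_injective _ (sptPairs.toPartition_injective hk))

theorem B0_eq_ncard {k n : ℕ} (hk : 1 ≤ k) : B0 k n = (sptPairs Even k n).ncard := by
  rw [← Nat.card_coe_set_eq, ← Nat.card_range_of_injective (sptPairs.toPartition_injective hk),
    sptPairs.range_toPartition hk]
  rfl

theorem B1_eq_ncard {k n : ℕ} (hk : 1 ≤ k) : B1 k n = (sptPairs Odd k n).ncard := by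
  rw [← Nat.card_coe_set_eq, ← Nat.card_range_of_injective (sptPairs.toPartition_injective hk),
    sptPairs.range_toPartition hk]
  rfl

theorem pde_eq_ncard (n : ℕ) : pde n = (evenSets n).ncard := by
  rw [← Nat.card_coe_set_eq]
  refine Nat.card_congr
    ⟨fun π => ⟨⟨π.1.parts, π.2.1⟩, fun x hx => ⟨π.1.parts_pos hx, π.2.2 x hx⟩, ?_⟩,
     fun T => ⟨⟨T.1.val, fun {x} hx => (T.2.1 x hx).1, ?_⟩, T.1.nodup, fun x hx => (T.2.1 x hx).2⟩,
     fun π => rfl, fun T => rfl⟩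
  · rw [Finset.sum_eq_multiset_sum, Multiset.map_id']
    exact π.1.parts_sum
  · rw [Finset.sum_val]
    exact T.2.2

theorem evenSets_finite (n : ℕ) : (evenSets n).Finite := by
  refine (Finset.finite_toSet (Finset.range (n + 1)).powerset).subset fun T hT => ?_
  simp only [Finset.coe_powerset, Set.mem_preimage, Set.mem_powerset_iff]
  intro x hx
  have := Finset.single_le_sum (f := fun x => x) (fun _ _ => Nat.zero_le _) hx
  have := hT.2
  simp
  omega

theorem sum_mod_two_of_forall {T : Finset ℕ} {a : ℕ} (h : ∀ x ∈ T, ¬ x % 2 = a % 2) :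
    (∑ x ∈ T, x) % 2 = T.card * (a + 1) % 2 := by
  rw [Finset.sum_nat_mod, Finset.sum_congr rfl fun x hx => show x % 2 = (a + 1) % 2 by
    have := h x hx
    omega, ← Finset.sum_nat_mod]
  simp

theorem odd_fst_of_mem_sptPairs_even {k t : ℕ} {p : ℕ × Finset ℕ}
    (hp : p ∈ sptPairs Even k (2 * t + 1)) : Odd p.1 := by
  obtain ⟨-, h, he, hs⟩ := hp
  have hm := sum_mod_two_of_forall fun x hx => (h x hx).2
  by_contra hodd
  obtain ⟨a, ha⟩ := Nat.not_odd_iff_even.1 hodd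
  have h1 : Even (k * p.1) := ⟨k * a, by rw [ha]; ring⟩
  have h2 : Even (p.2.card * (p.1 + 1)) := he.mul_right _
  rw [Nat.even_iff] at h1 h2
  omega

theorem odd_fst_of_mem_sptPairs_odd {k t : ℕ} {p : ℕ × Finset ℕ}
    (hp : p ∈ sptPairs Odd k (2 * t)) : Odd p.1 := by
  obtain ⟨-, h, ho, hs⟩ := hp
  have hm := sum_mod_two_of_forall fun x hx => (h x hx).2
  by_contra hodd
  have hev := Nat.not_odd_iff_even.1 hodd
  have h1 : Even (k * p.1) := hev.mul_left _
  have h2 : Odd (p.2.card * (p.1 + 1)) := ho.mul hev.add_one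
  rw [Nat.even_iff] at h1
  rw [Nat.odd_iff] at h2
  omega

theorem ncard_sptPairs_fst_eq_one {Q : ℕ → Prop} {k n m : ℕ} (h : k + m = n) :
    (sptPairs Q k n ∩ {p | p.1 = 1}).ncard = (evenSets m ∩ {T | Q T.card}).ncard := by
  refine Set.BijOn.ncard_eq (f := Prod.snd) (Set.InvOn.bijOn (f' := fun T => (1, T)) ⟨?_, ?_⟩ ?_ ?_)
  · rintro ⟨s, T⟩ ⟨-, rfl : s = 1⟩
    rfl
  · exact fun T _ => rfl
  · rintro ⟨s, T⟩ ⟨⟨-, hT, hQ, hs⟩, rfl : s = 1⟩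
    refine ⟨⟨fun x hx => ?_, ?_⟩, hQ⟩
    · have := hT x hx
      rw [Nat.even_iff]
      dsimp only at *
      omega
    · dsimp only at *
      omega
  · rintro T ⟨⟨hT, hs⟩, hQ⟩
    refine ⟨⟨one_pos, fun x hx => ?_, hQ, ?_⟩, rfl⟩
    · have := hT x hx
      rw [Nat.even_iff] at this
      dsimp only
      omega
    · dsimp only at *
      omega

theorem ncard_sptPairs_even_fst_ne_one {k t : ℕ} :
    (sptPairs Even k (2 * (t + k) + 1) \ {p | p.1 = 1}).ncard =
      (sptPairs Even k (2 * t + 1) \ {p | p.1 + 1 ∈ p.2}).ncard := by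
  refine Set.BijOn.ncard_eq (f := fun p => (p.1 - 2, p.2))
    (Set.InvOn.bijOn (f' := fun p => (p.1 + 2, p.2)) ⟨?_, ?_⟩ ?_ ?_)
  · rintro ⟨s, T⟩ ⟨hp, h1⟩
    obtain ⟨a, ha⟩ := odd_fst_of_mem_sptPairs_even hp
    simp at h1 ha ⊢
    omega
  · rintro ⟨s, T⟩ -
    simp
  · rintro ⟨s, T⟩ ⟨hp, h1⟩
    obtain ⟨a, ha⟩ := odd_fst_of_mem_sptPairs_even hp
    obtain ⟨-, hT, hQ, hs⟩ := hp
    dsimp only at *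
    change ¬ s = 1 at h1
    obtain ⟨b, rfl⟩ : ∃ b, s = b + 2 := ⟨s - 2, by omega⟩
    rw [Nat.add_sub_cancel]
    refine ⟨⟨by dsimp only; omega, fun x hx => ?_, hQ, ?_⟩, fun hmem => ?_⟩
    · have := hT x hx
      dsimp only
      omega
    · dsimp only
      rw [mul_add] at hs
      omega
    · have := hT _ hmem
      dsimp only at this
      omega
  · rintro ⟨s, T⟩ ⟨⟨hpos, hT, hQ, hs⟩, h1⟩
    change ¬ s + 1 ∈ T at h1
    dsimp only at *
    refine ⟨⟨by dsimp only; omega, fun x hx => ?_, hQ, ?_⟩, ?_⟩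
    · have := hT x hx
      have : x ≠ s + 1 := fun h => h1 (h ▸ hx)
      dsimp only
      omega
    · dsimp only
      rw [mul_add]
      omega
    · change ¬ s + 2 = 1
      omega

theorem ncard_sptPairs_odd_fst_ne_one {k t : ℕ} :
    (sptPairs Odd (k + 1) (2 * (t + k + 1)) \ {p | p.1 = 1}).ncard =
      (sptPairs Even k (2 * t + 1) ∩ {p | p.1 + 1 ∈ p.2}).ncard := by
  refine Set.BijOn.ncard_eq (f := fun p => (p.1 - 2, insert (p.1 - 1) p.2))
    (Set.InvOn.bijOn (f' := fun p => (p.1 + 2, p.2.erase (p.1 + 1))) ⟨?_, ?_⟩ ?_ ?_)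
  · rintro ⟨s, T⟩ ⟨hp, h1⟩
    obtain ⟨a, ha⟩ := odd_fst_of_mem_sptPairs_odd hp
    obtain ⟨-, hT, hQ, hs⟩ := hp
    dsimp only at *
    change ¬ s = 1 at h1
    obtain ⟨b, rfl⟩ : ∃ b, s = b + 2 := ⟨s - 2, by omega⟩
    have : b + 1 ∉ T := fun h => by
      have := hT _ h
      omega
    simp [this]
  · rintro ⟨s, T⟩ ⟨-, h1⟩
    change s + 1 ∈ T at h1
    simp [Finset.insert_erase h1]
  · rintro ⟨s, T⟩ ⟨hp, h1⟩
    obtain ⟨a, ha⟩ := odd_fst_of_mem_sptPairs_odd hp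
    obtain ⟨-, hT, hQ, hs⟩ := hp
    dsimp only at *
    change ¬ s = 1 at h1
    obtain ⟨b, rfl⟩ : ∃ b, s = b + 2 := ⟨s - 2, by omega⟩
    have hb : b + 1 ∉ T := fun h => by
      have := hT _ h
      omega
    rw [Nat.add_sub_cancel, show b + 2 - 1 = b + 1 by omega]
    refine ⟨⟨by dsimp only; omega, fun x hx => ?_, ?_, ?_⟩, Finset.mem_insert_self _ _⟩
    · dsimp only
      rcases Finset.mem_insert.1 hx with rfl | hx
      · omega
      · have := hT x hx
        omega
    · rw [Finset.card_insert_of_notMem hb]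
      exact hQ.add_one
    · dsimp only
      rw [Finset.sum_insert hb]
      linarith
  · rintro ⟨s, T⟩ ⟨hp, h1⟩
    obtain ⟨a, ha⟩ := odd_fst_of_mem_sptPairs_even hp
    obtain ⟨hpos, hT, hQ, hs⟩ := hp
    change s + 1 ∈ T at h1
    dsimp only at *
    refine ⟨⟨by dsimp only; omega, fun x hx => ?_, ?_, ?_⟩, ?_⟩
    · obtain ⟨hne, hx⟩ := Finset.mem_erase.1 hx
      have := hT x hx
      dsimp only
      omega
    · have := Finset.card_erase_add_one h1
      rw [← this] at hQ
      exact Nat.not_even_iff_odd.1 (Nat.even_add_one.1 hQ)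
    · have := Finset.sum_erase_add T (fun x => x) h1
      dsimp only at this ⊢
      linarith
    · change ¬ s + 2 = 1
      omega

theorem statement12 (k t : ℕ) (hk : 1 ≤ k) (ht : k + 1 ≤ t) :
    B0 k (2 * t - 1) + B1 (k + 1) (2 * t) =
      B0 k (2 * t - 2 * k - 1) + pde (2 * t - k - 1) := by
  obtain ⟨u, rfl⟩ : ∃ u, t = u + k + 1 := ⟨t - k - 1, by omega⟩
  rw [show 2 * (u + k + 1) - 1 = 2 * (u + k) + 1 by omega,
    show 2 * (u + k + 1) - 2 * k - 1 = 2 * u + 1 by omega,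
    show 2 * (u + k + 1) - k - 1 = 2 * u + k + 1 by omega,
    B0_eq_ncard hk, B0_eq_ncard hk, B1_eq_ncard (by omega), pde_eq_ncard,
    ← Set.ncard_inter_add_ncard_sdiff_eq_ncard (sptPairs Even k (2 * (u + k) + 1)) {p | p.1 = 1}
      (sptPairs_finite hk),
    ← Set.ncard_inter_add_ncard_sdiff_eq_ncard (sptPairs Odd (k + 1) (2 * (u + k + 1)))
      {p | p.1 = 1} (sptPairs_finite (by omega)),
    ← Set.ncard_inter_add_ncard_sdiff_eq_ncard (sptPairs Even k (2 * u + 1)) {p | p.1 + 1 ∈ p.2}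
      (sptPairs_finite hk),
    ← Set.ncard_inter_add_ncard_sdiff_eq_ncard (evenSets (2 * u + k + 1)) {T | Even T.card}
      (evenSets_finite _),
    ncard_sptPairs_fst_eq_one (m := 2 * u + k + 1) (by omega),
    ncard_sptPairs_fst_eq_one (m := 2 * u + k + 1) (by omega),
    ncard_sptPairs_even_fst_ne_one, ncard_sptPairs_odd_fst_ne_one]
  have : evenSets (2 * u + k + 1) \ {T | Even T.card} =
      evenSets (2 * u + k + 1) ∩ {T | Odd T.card} := by
    ext T
    simp
  rw [this]
  omega
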